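/- Let n ≥ 2 be a natural number and let a, b, c be real numbers satisfying: a > 0, a + b > 0, c + 2a + 4b > 0, and (a+b)² < (n/(n−1))·a·(c + 2a + 4b). Then for every nonzero complex n×n matrix ξ = (ξ_{αβ})_{1 ≤ α,β ≤ n}, the real quantity a·(|tr ξ|² + ∑_{α,β} |ξ_{αβ}|²) + b·(∑_{β} |ξ_{1β}|² + ∑_{α} |ξ_{α1}|² + 2·Re(ξ_{11}·conj(tr ξ))) + c·|ξ_{11}|² is strictly positive. -/

import Mathlib

open Finset

theorem aux_real (m a p K X T R C S I : ℝ) (hm : 0 < m) (ha : 0 < a) (hp : 0 < p) (hK : 0 < K)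
    (hD : p ^ 2 * m < (m + 1) * a * K) (hT : 0 ≤ T)
    (hR : 0 ≤ R) (hC : 0 ≤ C) (hS : 0 ≤ S) (hTS : T ^ 2 ≤ m * S) (hI : -(X * T) ≤ I)
    (hne : 0 < X ^ 2 + R + C + S) :
    0 < K * X ^ 2 + 2 * p * I + a * T ^ 2 + p * (R + C) + a * S := by
  have h1 : 0 ≤ p * (R + C) := by positivity
  have h2 : 0 ≤ p * (I + X * T) := mul_nonneg hp.le (by linarith)
  have h3 : 0 ≤ a * (m * S - T ^ 2) := mul_nonneg ha.le (by linarith)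
  have key : K * m * (K * X ^ 2 - 2 * p * (X * T) + a * T ^ 2 + a * S)
      = m * (K * X - p * T) ^ 2 + ((m + 1) * a * K - p ^ 2 * m) * T ^ 2
        + K * (a * (m * S - T ^ 2)) := by ring
  have hKm : 0 < K * m := by positivity
  rcases hT.eq_or_lt with h | h
  · subst h
    have hI' : 0 ≤ p * I := mul_nonneg hp.le (by simpa using hI)
    by_contra hcon
    have e1 : 0 ≤ K * X ^ 2 := by positivity
    have e2 : 0 ≤ p * R := by positivity
    have e3 : 0 ≤ p * C := by positivity
    have e4 : 0 ≤ a * S := by positivity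
    have f1 : K * X ^ 2 = 0 := by nlinarith
    have f2 : p * R = 0 := by nlinarith
    have f3 : p * C = 0 := by nlinarith
    have f4 : a * S = 0 := by nlinarith
    have g1 := (mul_eq_zero.1 f1).resolve_left hK.ne'
    have g2 := (mul_eq_zero.1 f2).resolve_left hp.ne'
    have g3 := (mul_eq_zero.1 f3).resolve_left hp.ne'
    have g4 := (mul_eq_zero.1 f4).resolve_left ha.ne'
    linarith
  · have hpos : 0 < K * m * (K * X ^ 2 - 2 * p * (X * T) + a * T ^ 2 + a * S) := by
      rw [key]
      have : 0 < ((m + 1) * a * K - p ^ 2 * m) * T ^ 2 :=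
        mul_pos (by linarith) (by positivity)
      have : 0 ≤ K * (a * (m * S - T ^ 2)) := by positivity
      have : 0 ≤ m * (K * X - p * T) ^ 2 := by positivity
      linarith
    have := (mul_pos_iff_of_pos_left hKm).1 hpos
    linarith

theorem stmt_15 (n : ℕ) (hn : 2 ≤ n) (a b c : ℝ)
    (ha : 0 < a) (hab : 0 < a + b) (hc : 0 < c + 2 * a + 4 * b)
    (hD : (a + b) ^ 2 < ((n : ℝ) / ((n : ℝ) - 1)) * a * (c + 2 * a + 4 * b))
    (ξ : Matrix (Fin n) (Fin n) ℂ) (hξ : ξ ≠ 0) :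
    0 < a * (‖∑ α, ξ α α‖ ^ 2 + ∑ α, ∑ β, ‖ξ α β‖ ^ 2)
        + b * ((∑ β, ‖ξ ⟨0, by omega⟩ β‖ ^ 2) +
            (∑ α, ‖ξ α ⟨0, by omega⟩‖ ^ 2) +
            2 * (ξ ⟨0, by omega⟩ ⟨0, by omega⟩ *
              (starRingEnd ℂ) (∑ α, ξ α α)).re)
        + c * ‖ξ ⟨0, by omega⟩ ⟨0, by omega⟩‖ ^ 2 := by
  obtain ⟨m, rfl⟩ : ∃ m, n = m + 1 := ⟨n - 1, by omega⟩
  have hm : (0 : ℝ) < m := by exact_mod_cast (by omega : 0 < m)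
  have hz : ∀ h : 0 < m + 1, (⟨0, h⟩ : Fin (m + 1)) = 0 := fun _ => rfl
  simp only [hz]
  have hnn : 0 < ∑ α, ∑ β, ‖ξ α β‖ ^ 2 := by
    obtain ⟨i, j, hij⟩ : ∃ i j, ξ i j ≠ 0 := by
      by_contra! h
      exact hξ (by ext i j; simpa using h i j)
    refine sum_pos' (fun _ _ => by positivity) ⟨i, mem_univ _, ?_⟩
    exact sum_pos' (fun _ _ => by positivity) ⟨j, mem_univ _, by positivity⟩
  have hD' : (a + b) ^ 2 * m < (m + 1) * a * (c + 2 * a + 4 * b) := by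
    push_cast at hD
    rw [add_sub_cancel_right, div_mul_eq_mul_div, div_mul_eq_mul_div, lt_div_iff₀ hm] at hD
    exact hD
  simp only [Fin.sum_univ_succ, sum_add_distrib] at hnn ⊢
  set x := ξ 0 0
  set s := ∑ i : Fin m, ξ i.succ i.succ with hs
  set R := ∑ i : Fin m, ‖ξ 0 i.succ‖ ^ 2 with hR
  set C := ∑ i : Fin m, ‖ξ i.succ 0‖ ^ 2 with hC
  set S := ∑ i : Fin m, ∑ j : Fin m, ‖ξ i.succ j.succ‖ ^ 2 with hS
  have hTS : ‖s‖ ^ 2 ≤ m * S := by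
    calc ‖s‖ ^ 2 ≤ (∑ i : Fin m, ‖ξ i.succ i.succ‖) ^ 2 := by
          gcongr; exact norm_sum_le _ _
      _ ≤ m * ∑ i : Fin m, ‖ξ i.succ i.succ‖ ^ 2 := by
          simpa using sq_sum_le_card_mul_sum_sq (s := (univ : Finset (Fin m)))
            (f := fun i => ‖ξ i.succ i.succ‖)
      _ ≤ m * S := by
          refine mul_le_mul_of_nonneg_left (sum_le_sum fun i _ => ?_) hm.le
          exact single_le_sum (f := fun j : Fin m => ‖ξ i.succ j.succ‖ ^ 2)
            (fun _ _ => by positivity) (mem_univ i)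
  have hI : -(‖x‖ * ‖s‖) ≤ (x * (starRingEnd ℂ) s).re := by
    have := Complex.abs_re_le_norm (x * (starRingEnd ℂ) s)
    rw [norm_mul, Complex.norm_conj] at this
    exact (abs_le.1 this).1
  have main := aux_real m a (a + b) (c + 2 * a + 4 * b) ‖x‖ ‖s‖ R C S _ hm ha hab hc hD'
    (norm_nonneg _) (by positivity) (by positivity) (by positivity) hTS hI
    (by linarith)
  have e1 : ‖x + s‖ ^ 2 = ‖x‖ ^ 2 + ‖s‖ ^ 2 + 2 * (x * (starRingEnd ℂ) s).re := by
    simp only [Complex.sq_norm]; exact Complex.normSq_add x s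
  have e2 : (x * (starRingEnd ℂ) (x + s)).re = ‖x‖ ^ 2 + (x * (starRingEnd ℂ) s).re := by
    rw [map_add, mul_add, Complex.add_re, Complex.mul_conj, Complex.ofReal_re, Complex.sq_norm]
  rw [e1, e2]
  linarith
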